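/- Nonlinear Kolmogorov weak law of large numbers, two-sided form (claim (6)): under the standing assumptions, and assuming that for each n the truncated variables (Y_{n,k}, 1 ≤ k ≤ n) are pairwise nonlinearly independent, i.e. for all i ≠ k and all functions φ, ψ : ℝ → ℝ satisfying |φ(x) − φ(y)| ≤ C(1 + |x|^m + |y|^m)|x − y| for some C > 0 and m ∈ ℕ (and similarly for ψ) one has 𝔼[φ(Y_{n,k}) ψ(Y_{n,i})] = 𝔼[φ(Y_{n,k})] · 𝔼[ψ(Y_{n,i})], it holds that for every ε > 0, v(μ̲_n − ε < S_n/n < μ̄_n + ε) → 1 as n → ∞. -/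

import Mathlib

open MeasureTheory Filter

noncomputable def upperExp {Ω : Type*} [MeasurableSpace Ω] (Ps : Set (Measure Ω)) (Z : Ω → ℝ) : ℝ :=
  ⨆ P : Ps, ∫ ω, Z ω ∂(P : Measure Ω)

noncomputable def lowerExp {Ω : Type*} [MeasurableSpace Ω] (Ps : Set (Measure Ω)) (Z : Ω → ℝ) : ℝ :=
  ⨅ P : Ps, ∫ ω, Z ω ∂(P : Measure Ω)

noncomputable def upperCap {Ω : Type*} [MeasurableSpace Ω] (Ps : Set (Measure Ω)) (A : Set Ω) : ℝ :=
  ⨆ P : Ps, ((P : Measure Ω) A).toReal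

noncomputable def lowerCap {Ω : Type*} [MeasurableSpace Ω] (Ps : Set (Measure Ω)) (A : Set Ω) : ℝ :=
  ⨅ P : Ps, ((P : Measure Ω) A).toReal

section Auxiliary

variable {Ω : Type*} [MeasurableSpace Ω]

lemma integral_le_upperExp {Ps : Set (Measure Ω)} (hprob : ∀ P ∈ Ps, IsProbabilityMeasure P)
    {Z : Ω → ℝ} {C : ℝ} (hZ : ∀ ω, |Z ω| ≤ C) {P : Measure Ω} (hP : P ∈ Ps) :
    ∫ ω, Z ω ∂P ≤ upperExp Ps Z := by
  refine le_ciSup (f := fun P : Ps => ∫ ω, Z ω ∂(P : Measure Ω)) ⟨C, ?_⟩ ⟨P, hP⟩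
  rintro _ ⟨⟨Q, hQ⟩, rfl⟩
  have := hprob Q hQ
  have h := norm_integral_le_of_norm_le_const (μ := Q) (f := Z) (Eventually.of_forall hZ)
  rw [probReal_univ, mul_one] at h
  exact (le_abs_self _).trans h

lemma upperExp_const {Ps : Set (Measure Ω)} (hne : Ps.Nonempty)
    (hprob : ∀ P ∈ Ps, IsProbabilityMeasure P) (c : ℝ) : upperExp Ps (fun _ => c) = c := by
  have : Nonempty Ps := hne.to_subtype
  have h : ∀ P : Ps, ∫ _, c ∂(P : Measure Ω) = c := fun P => by
    have := hprob P P.2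
    simp
  simp [upperExp, h]

lemma measureReal_le_upperCap {Ps : Set (Measure Ω)} (hprob : ∀ P ∈ Ps, IsProbabilityMeasure P)
    (A : Set Ω) {P : Measure Ω} (hP : P ∈ Ps) : P.real A ≤ upperCap Ps A := by
  refine le_ciSup (f := fun P : Ps => ((P : Measure Ω) A).toReal) ⟨1, ?_⟩ ⟨P, hP⟩
  rintro _ ⟨⟨Q, hQ⟩, rfl⟩
  have := hprob Q hQ
  exact measureReal_le_one

lemma upperCap_nonneg (Ps : Set (Measure Ω)) (A : Set Ω) : 0 ≤ upperCap Ps A :=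
  Real.iSup_nonneg fun _ => ENNReal.toReal_nonneg

lemma lowerCap_le_one {Ps : Set (Measure Ω)} (hne : Ps.Nonempty)
    (hprob : ∀ P ∈ Ps, IsProbabilityMeasure P) (A : Set Ω) : lowerCap Ps A ≤ 1 := by
  obtain ⟨P, hP⟩ := hne
  have := hprob P hP
  refine (ciInf_le (f := fun P : Ps => ((P : Measure Ω) A).toReal) ⟨0, ?_⟩ ⟨P, hP⟩).trans
    measureReal_le_one
  rintro _ ⟨Q, rfl⟩
  exact ENNReal.toReal_nonneg

/-- If the upper expectation changes sign with `Z`, then all measures agree on the mean of `Z`. -/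
lemma integral_eq_upperExp {Ps : Set (Measure Ω)} (hprob : ∀ P ∈ Ps, IsProbabilityMeasure P)
    {Z : Ω → ℝ} {C : ℝ} (hZ : ∀ ω, |Z ω| ≤ C)
    (hneg : upperExp Ps (fun ω => -Z ω) = -upperExp Ps Z) {P : Measure Ω} (hP : P ∈ Ps) :
    ∫ ω, Z ω ∂P = upperExp Ps Z := by
  have h := integral_le_upperExp hprob (Z := fun ω => -Z ω) (C := C) (by simpa using hZ) hP
  rw [integral_neg, hneg] at h
  exact le_antisymm (integral_le_upperExp hprob hZ hP) (neg_le_neg_iff.1 h)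

lemma lintegral_sq_min_le (P : Measure Ω) {Z : Ω → ℝ} (hZ : Measurable Z) {n : ℝ} (hn : 0 < n) :
    ∫⁻ ω, ENNReal.ofReal ((min (|Z ω| / n) 1) ^ 2) ∂P ≤
      2 * ∫⁻ t in Set.Icc (0 : ℝ) 1, P {ω | n * t < |Z ω|} * ENNReal.ofReal t := by
  have h := lintegral_rpow_eq_lintegral_meas_lt_mul P (f := fun ω => min (|Z ω| / n) 1)
    (Eventually.of_forall fun ω => by positivity) (by fun_prop) (p := 2) two_pos
  simp only [Real.rpow_two, ENNReal.ofReal_ofNat] at h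
  rw [h]
  gcongr 2 * ?_
  rw [← lintegral_indicator measurableSet_Ioi, ← lintegral_indicator measurableSet_Icc]
  refine lintegral_mono fun t => Set.indicator_le (fun t ht => ?_) t
  rcases le_or_gt t 1 with h1 | h1
  · rw [Set.indicator_of_mem (show t ∈ Set.Icc (0 : ℝ) 1 from ⟨le_of_lt ht, h1⟩),
      show (2 : ℝ) - 1 = 1 by norm_num, Real.rpow_one]
    gcongr P ?_ * _
    intro ω hω
    rw [Set.mem_ofPred_eq, lt_min_iff, lt_div_iff₀' hn] at hω
    exact hω.1
  · have : {ω | t < min (|Z ω| / n) 1} = ∅ := by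
      ext ω
      simp [h1.le]
    rw [this, measure_empty, zero_mul]
    exact zero_le

lemma sum_integral_sq_min_le {ι : Type*} (s : Finset ι) (P : Measure Ω) [IsProbabilityMeasure P]
    {Z : ι → Ω → ℝ} (hZ : ∀ k, Measurable (Z k)) {n : ℝ} (hn : 0 < n) {g : ℝ → ℝ}
    (hg : ∀ t ∈ Set.Icc (0 : ℝ) 1, ∑ k ∈ s, P.real {ω | n * t < |Z k ω|} * t ≤ g t)
    (hgi : eLpNorm g 1 (volume.restrict (Set.Icc (0 : ℝ) 1)) ≠ ⊤) :
    ∑ k ∈ s, ∫ ω, (min (|Z k ω| / n) 1) ^ 2 ∂P ≤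
      2 * (eLpNorm g 1 (volume.restrict (Set.Icc (0 : ℝ) 1))).toReal := by
  have hint : ∀ k, Integrable (fun ω => (min (|Z k ω| / n) 1) ^ 2) P := fun k => by
    have := hZ k
    refine Integrable.of_bound (by fun_prop) 1 (Eventually.of_forall fun ω => ?_)
    rw [Real.norm_of_nonneg (by positivity)]
    exact pow_le_one₀ (by positivity) (min_le_right _ _)
  rw [← ENNReal.toReal_ofNat, ← ENNReal.toReal_mul]
  refine (ENNReal.ofReal_le_iff_le_toReal (ENNReal.mul_ne_top (by simp) hgi)).1 ?_
  rw [ENNReal.ofReal_sum_of_nonneg fun k _ => integral_nonneg fun ω => by positivity]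
  calc ∑ k ∈ s, ENNReal.ofReal (∫ ω, (min (|Z k ω| / n) 1) ^ 2 ∂P)
      = ∑ k ∈ s, ∫⁻ ω, ENNReal.ofReal ((min (|Z k ω| / n) 1) ^ 2) ∂P :=
        Finset.sum_congr rfl fun k _ => ofReal_integral_eq_lintegral_ofReal (hint k)
          (Eventually.of_forall fun ω => by positivity)
    _ ≤ ∑ k ∈ s, 2 * ∫⁻ t in Set.Icc (0 : ℝ) 1, P {ω | n * t < |Z k ω|} * ENNReal.ofReal t :=
        Finset.sum_le_sum fun k _ => lintegral_sq_min_le P (hZ k) hn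
    _ = 2 * ∫⁻ t in Set.Icc (0 : ℝ) 1,
          ∑ k ∈ s, P {ω | n * t < |Z k ω|} * ENNReal.ofReal t := by
        rw [lintegral_finsetSum, Finset.mul_sum]
        intro k _
        refine Measurable.mul (Antitone.measurable fun a b hab => measure_mono fun ω hω => ?_)
          (by fun_prop)
        exact lt_of_le_of_lt (mul_le_mul_of_nonneg_left hab hn.le) hω
    _ ≤ 2 * eLpNorm g 1 (volume.restrict (Set.Icc (0 : ℝ) 1)) := by
        rw [eLpNorm_one_eq_lintegral_enorm]
        gcongr 2 * ?_
        refine setLIntegral_mono' measurableSet_Icc fun t ht => ?_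
        calc ∑ k ∈ s, P {ω | n * t < |Z k ω|} * ENNReal.ofReal t
            = ENNReal.ofReal (∑ k ∈ s, P.real {ω | n * t < |Z k ω|} * t) := by
              rw [ENNReal.ofReal_sum_of_nonneg fun k _ => mul_nonneg measureReal_nonneg ht.1]
              refine Finset.sum_congr rfl fun k _ => ?_
              rw [ENNReal.ofReal_mul measureReal_nonneg, ofReal_measureReal]
          _ ≤ ENNReal.ofReal (g t) := ENNReal.ofReal_le_ofReal (hg t ht)
          _ ≤ ‖g t‖ₑ := Real.ofReal_le_enorm _

/-- Chebyshev's inequality for sums of negatively correlated random variables. -/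
lemma measureReal_abs_sum_sub_ge_le {ι : Type*} (s : Finset ι) (P : Measure Ω)
    [IsProbabilityMeasure P] {Y : ι → Ω → ℝ} (hY : ∀ k ∈ s, MemLp (Y k) 2 P)
    (hcov : ∀ i ∈ s, ∀ k ∈ s, i ≠ k →
      ∫ ω, Y i ω * Y k ω ∂P ≤ (∫ ω, Y i ω ∂P) * ∫ ω, Y k ω ∂P)
    {c : ℝ} (hc : 0 < c) :
    P.real {ω | c ≤ |∑ k ∈ s, Y k ω - ∑ k ∈ s, ∫ ω, Y k ω ∂P|} ≤
      (∑ k ∈ s, ∫ ω, Y k ω ^ 2 ∂P) / c ^ 2 := by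
  classical
  have hsum : MemLp (fun ω => ∑ k ∈ s, Y k ω) 2 P := memLp_finsetSum _ hY
  have hvar : ProbabilityTheory.variance (fun ω => ∑ k ∈ s, Y k ω) P ≤
      ∑ k ∈ s, ∫ ω, Y k ω ^ 2 ∂P := by
    rw [ProbabilityTheory.variance_fun_sum' hY]
    refine Finset.sum_le_sum fun i hi => ?_
    rw [← Finset.add_sum_erase s _ hi, ProbabilityTheory.covariance_self (hY i hi).aemeasurable]
    have h1 := ProbabilityTheory.variance_le_expectation_sq (hY i hi).1
    have h2 : ∑ k ∈ s.erase i, ProbabilityTheory.covariance (Y i) (Y k) P ≤ 0 := by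
      refine Finset.sum_nonpos fun k hk => ?_
      have hks := Finset.mem_of_mem_erase hk
      rw [ProbabilityTheory.covariance_eq_sub (hY i hi) (hY k hks)]
      exact sub_nonpos.2 (hcov i hi k hks (Finset.ne_of_mem_erase hk).symm)
    simp only [Pi.pow_apply] at h1
    linarith
  have h := ProbabilityTheory.meas_ge_le_variance_div_sq hsum hc
  rw [integral_finsetSum _ fun k hk => (hY k hk).integrable one_le_two] at h
  refine ENNReal.toReal_le_of_le_ofReal
    (div_nonneg (Finset.sum_nonneg fun k _ => integral_nonneg fun ω => sq_nonneg _)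
      (sq_nonneg c)) (h.trans (ENNReal.ofReal_le_ofReal ?_))
  gcongr

end Auxiliary

/-- nonlinear Kolmogorov WLLN, two-sided form: under the standing
assumptions and pairwise nonlinear independence of the truncated variables,
for every ε > 0, v(μ̲ₙ − ε < Sₙ/n < μ̄ₙ + ε) → 1. -/
theorem nonlinear_wlln_two_sided
    {Ω : Type*} [MeasurableSpace Ω] (Ps : Set (Measure Ω)) (hne : Ps.Nonempty)
    (hprob : ∀ P ∈ Ps, IsProbabilityMeasure P)
    (X : ℕ → Ω → ℝ) (hX : ∀ k, Measurable (X k))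
    (χ : ℕ → ℝ → ℝ)
    (hχLip : ∀ n, ∃ K : NNReal, LipschitzWith K (χ n))
    (hχone : ∀ n : ℕ, ∀ x : ℝ, |x| ≤ (n : ℝ) → χ n x = 1)
    (hχzero : ∀ n : ℕ, ∀ x : ℝ, (n : ℝ) + 1 ≤ |x| → χ n x = 0)
    (hχrange : ∀ n : ℕ, ∀ x : ℝ, χ n x ∈ Set.Icc (0 : ℝ) 1)
    (Y : ℕ → ℕ → Ω → ℝ) (hY : ∀ n k, Y n k = fun ω => X k ω * χ n |X k ω|)
    (S : ℕ → Ω → ℝ) (hS : ∀ n, S n = fun ω => ∑ k ∈ Finset.Icc 1 n, X k ω)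
    (ψ : ℕ → ℝ → ℝ)
    (hψ : ∀ n : ℕ, ∀ y : ℝ, ψ n y = ∑ k ∈ Finset.Icc 1 n, y * upperCap Ps {ω | (n : ℝ) * y < |X k ω|})
    (hψ0 : ∀ y ∈ Set.Icc (0 : ℝ) 1, Tendsto (fun n => ψ n y) atTop (nhds 0))
    (hUI : UniformIntegrable (fun n : ℕ => ψ n) 1 (volume.restrict (Set.Icc (0 : ℝ) 1)))
    (μp : ℕ → ℕ → ℝ) (hμp : ∀ n k, μp n k = upperExp Ps (Y n k))
    (μm : ℕ → ℕ → ℝ) (hμm : ∀ n k, μm n k = lowerExp Ps (Y n k))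
    (μbar : ℕ → ℝ) (hμbar : ∀ n : ℕ, μbar n = (1 / (n : ℝ)) * ∑ k ∈ Finset.Icc 1 n, μp n k)
    (μlow : ℕ → ℝ) (hμlow : ∀ n : ℕ, μlow n = (1 / (n : ℝ)) * ∑ k ∈ Finset.Icc 1 n, μm n k)
    (hindep : ∀ n : ℕ, ∀ i ∈ Finset.Icc 1 n, ∀ k ∈ Finset.Icc 1 n, i ≠ k →
      ∀ φ₁ φ₂ : ℝ → ℝ,
      (∃ C : ℝ, 0 < C ∧ ∃ m : ℕ, ∀ x y : ℝ,
        |φ₁ x - φ₁ y| ≤ C * (1 + |x| ^ m + |y| ^ m) * |x - y|) →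
      (∃ C : ℝ, 0 < C ∧ ∃ m : ℕ, ∀ x y : ℝ,
        |φ₂ x - φ₂ y| ≤ C * (1 + |x| ^ m + |y| ^ m) * |x - y|) →
      upperExp Ps (fun ω => φ₁ (Y n k ω) * φ₂ (Y n i ω)) =
        upperExp Ps (fun ω => φ₁ (Y n k ω)) * upperExp Ps (fun ω => φ₂ (Y n i ω)))
    :
    ∀ ε : ℝ, 0 < ε →
      Tendsto (fun n => lowerCap Ps {ω | μlow n - ε < S n ω / n ∧ S n ω / n < μbar n + ε})
        atTop (nhds 1) := by
  intro ε hε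
  set I : ℕ → ℝ := fun n =>
    (eLpNorm (ψ n) 1 (volume.restrict (Set.Icc (0 : ℝ) 1))).toReal with hI
  have hIlim : Tendsto I atTop (nhds 0) := by
    have h := tendsto_Lp_finite_of_tendsto_ae (μ := volume.restrict (Set.Icc (0 : ℝ) 1)) le_rfl
      ENNReal.one_ne_top (fun n => hUI.aestronglyMeasurable n) (MemLp.zero (ε := ℝ)) hUI.unifIntegrable
      ((ae_restrict_iff' measurableSet_Icc).2 (Eventually.of_forall hψ0))
    simp only [sub_zero] at h
    exact (ENNReal.tendsto_toReal ENNReal.zero_ne_top).comp h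
  have hψ1 := hψ0 1 (by simp)
  have hlim : Tendsto (fun n => 1 - (ψ n 1 + (4 * ψ n 1 + 2 * I n) / ε ^ 2)) atTop (nhds 1) := by
    simpa using ((hψ1.add (((hψ1.const_mul 4).add (hIlim.const_mul 2)).div_const
      (ε ^ 2))).const_sub 1)
  have : Nonempty Ps := hne.to_subtype
  refine tendsto_of_tendsto_of_tendsto_of_le_of_le' hlim tendsto_const_nhds ?_
    (Eventually.of_forall fun n => lowerCap_le_one hne hprob _)
  filter_upwards [eventually_ge_atTop 2] with n hn
  have hn0 : (0 : ℝ) < n := by positivity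
  have hn1 : (1 : ℝ) ≤ n := by exact_mod_cast (by omega : 1 ≤ n)
  have hYX : ∀ k ω, |Y n k ω| ≤ |X k ω| := fun k ω => by
    obtain ⟨h0, h1⟩ := hχrange n |X k ω|
    simp only [hY, abs_mul, abs_of_nonneg h0]
    exact mul_le_of_le_one_right (abs_nonneg _) h1
  have hYb : ∀ k ω, |Y n k ω| ≤ n + 1 := fun k ω => by
    rcases le_or_gt ((n : ℝ) + 1) |X k ω| with h | h
    · have := hχzero n |X k ω| (by rwa [abs_abs])
      simp only [hY, this, mul_zero, abs_zero]
      positivity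
    · exact (hYX k ω).trans h.le
  have hYm : ∀ k, Measurable (Y n k) := fun k => by
    obtain ⟨K, hK⟩ := hχLip n
    have := hK.continuous.measurable
    have := hX k
    rw [hY]
    fun_prop
  have hYeq : ∀ k ω, |X k ω| ≤ n → Y n k ω = X k ω := fun k ω h => by
    simp only [hY]
    rw [hχone n _ (by rwa [abs_abs]), mul_one]
  have hid : ∃ C : ℝ, 0 < C ∧ ∃ m : ℕ, ∀ x y : ℝ,
      |id x - id y| ≤ C * (1 + |x| ^ m + |y| ^ m) * |x - y| := by
    refine ⟨1, one_pos, 0, fun x y => ?_⟩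
    have := abs_nonneg (x - y)
    simp only [id, pow_zero]
    linarith
  have hconst : ∃ C : ℝ, 0 < C ∧ ∃ m : ℕ, ∀ x y : ℝ,
      |(fun _ : ℝ => (-1 : ℝ)) x - (fun _ : ℝ => (-1 : ℝ)) y| ≤
        C * (1 + |x| ^ m + |y| ^ m) * |x - y| := by
    refine ⟨1, one_pos, 0, fun x y => ?_⟩
    simp only [sub_self, abs_zero]
    positivity
  have hneg : ∀ k ∈ Finset.Icc 1 n,
      upperExp Ps (fun ω => -Y n k ω) = -upperExp Ps (Y n k) := fun k hk => by
    obtain ⟨i, hi, hik⟩ : ∃ i ∈ Finset.Icc 1 n, i ≠ k := by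
      rcases eq_or_ne k 1 with rfl | h
      · exact ⟨2, by simp [hn], by norm_num⟩
      · exact ⟨1, by simp; omega, h.symm⟩
    have h := hindep n i hi k hk hik id (fun _ => -1) hid hconst
    simpa [upperExp_const hne hprob] using h
  have hmean : ∀ P ∈ Ps, ∀ k ∈ Finset.Icc 1 n, ∫ ω, Y n k ω ∂P = μp n k := fun P hP k hk => by
    rw [hμp, integral_eq_upperExp hprob (hYb k) (hneg k hk) hP]
  have hμ : ∀ k ∈ Finset.Icc 1 n, μm n k = μp n k := fun k hk => by
    rw [hμm, lowerExp, iInf_congr fun P : Ps => hmean P P.2 k hk, ciInf_const]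
  have hlow : μlow n = μbar n := by
    rw [hμlow, hμbar, Finset.sum_congr rfl hμ]
  refine le_ciInf fun ⟨P, hP⟩ => ?_
  have := hprob P hP
  have hMem : ∀ k, MemLp (Y n k) 2 P := fun k =>
    MemLp.of_bound (hYm k).aestronglyMeasurable (n + 1) (Eventually.of_forall (hYb k))
  have htail : ∑ k ∈ Finset.Icc 1 n, P.real {ω | (n : ℝ) < |X k ω|} ≤ ψ n 1 := by
    rw [hψ]
    refine Finset.sum_le_sum fun k _ => ?_
    rw [one_mul, mul_one]
    exact measureReal_le_upperCap hprob _ hP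
  have hsq : ∑ k ∈ Finset.Icc 1 n, ∫ ω, Y n k ω ^ 2 ∂P ≤ n ^ 2 * (4 * ψ n 1 + 2 * I n) := by
    have hmin := sum_integral_sq_min_le (Finset.Icc 1 n) P hX hn0 (g := ψ n) (fun t ht => by
      rw [hψ]
      refine Finset.sum_le_sum fun k _ => ?_
      rw [mul_comm]
      exact mul_le_mul_of_nonneg_left (measureReal_le_upperCap hprob _ hP) ht.1)
      (hUI.memLp n).eLpNorm_ne_top
    have hterm : ∀ k, ∫ ω, Y n k ω ^ 2 ∂P ≤ (n + 1 : ℝ) ^ 2 * P.real {ω | (n : ℝ) < |X k ω|} +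
        n ^ 2 * ∫ ω, (min (|X k ω| / n) 1) ^ 2 ∂P := fun k => by
      have hA : MeasurableSet {ω | (n : ℝ) < |X k ω|} :=
        measurableSet_lt measurable_const (hX k).abs
      have hint1 : Integrable ({ω | (n : ℝ) < |X k ω|}.indicator fun _ => (n + 1 : ℝ) ^ 2) P :=
        (integrable_const _).indicator hA
      have hint2 : Integrable (fun ω => (n : ℝ) ^ 2 * (min (|X k ω| / n) 1) ^ 2) P := by
        have := hX k
        refine (Integrable.of_bound (by fun_prop) 1 (Eventually.of_forall fun ω => ?_)).const_mul _
        rw [Real.norm_of_nonneg (by positivity)]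
        exact pow_le_one₀ (by positivity) (min_le_right _ _)
      rw [← integral_const_mul, mul_comm _ (P.real _), ← smul_eq_mul (P.real _),
        ← integral_indicator_const _ hA, ← integral_add hint1 hint2]
      refine integral_mono (hMem k).integrable_sq (hint1.add hint2) fun ω => ?_
      rcases lt_or_ge (n : ℝ) |X k ω| with h | h
      · have h1 : Y n k ω ^ 2 ≤ (n + 1 : ℝ) ^ 2 := by
          rw [← sq_abs]
          exact pow_le_pow_left₀ (abs_nonneg _) (hYb k ω) 2
        have h2 : (0 : ℝ) ≤ n ^ 2 * (min (|X k ω| / n) 1) ^ 2 := by positivity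
        simp only [Set.indicator_of_mem (show ω ∈ {ω | (n : ℝ) < |X k ω|} from h)]
        linarith
      · simp only [Set.indicator_of_notMem (show ω ∉ {ω | (n : ℝ) < |X k ω|} from not_lt.2 h)]
        rw [min_eq_left ((div_le_one hn0).2 h), hYeq k ω h, div_pow, sq_abs, zero_add]
        field_simp
        exact le_rfl
    have hψnn : 0 ≤ ψ n 1 :=
      (Finset.sum_nonneg fun k _ => measureReal_nonneg).trans htail
    calc ∑ k ∈ Finset.Icc 1 n, ∫ ω, Y n k ω ^ 2 ∂P
        ≤ (n + 1 : ℝ) ^ 2 * ∑ k ∈ Finset.Icc 1 n, P.real {ω | (n : ℝ) < |X k ω|} +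
          n ^ 2 * ∑ k ∈ Finset.Icc 1 n, ∫ ω, (min (|X k ω| / n) 1) ^ 2 ∂P := by
          rw [Finset.mul_sum, Finset.mul_sum, ← Finset.sum_add_distrib]
          exact Finset.sum_le_sum fun k _ => hterm k
      _ ≤ (n + n : ℝ) ^ 2 * ψ n 1 + n ^ 2 * (2 * I n) := by gcongr
      _ = n ^ 2 * (4 * ψ n 1 + 2 * I n) := by ring
  have hcheb := measureReal_abs_sum_sub_ge_le (Finset.Icc 1 n) P (fun k _ => hMem k)
    (fun i hi k hk hik => by
      rw [hmean P hP i hi, hmean P hP k hk, hμp, hμp]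
      have h := hindep n k hk i hi hik.symm id id hid hid
      simp only [id] at h
      rw [← h]
      refine integral_le_upperExp hprob (C := (n + 1) * (n + 1)) (fun ω => ?_) hP
      rw [abs_mul]
      exact mul_le_mul (hYb i ω) (hYb k ω) (abs_nonneg _) (by positivity)) (mul_pos hn0 hε)
  rw [Finset.sum_congr rfl (hmean P hP)] at hcheb
  set E := {ω | μlow n - ε < S n ω / n ∧ S n ω / n < μbar n + ε}
  set B := {ω | n * ε ≤ |∑ k ∈ Finset.Icc 1 n, Y n k ω - ∑ k ∈ Finset.Icc 1 n, μp n k|}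
  have hcover : Set.univ ⊆ E ∪ (B ∪ ⋃ k ∈ Finset.Icc 1 n, {ω | (n : ℝ) < |X k ω|}) := by
    intro ω _
    by_contra hω
    simp only [Set.mem_union, Set.mem_iUnion, not_or, not_exists, Set.mem_ofPred_eq, not_lt] at hω
    obtain ⟨hE, hB, hU⟩ := hω
    rw [Set.mem_ofPred_eq] at hB
    refine hE ?_
    have hS' : S n ω = ∑ k ∈ Finset.Icc 1 n, Y n k ω := by
      simp only [hS]
      exact Finset.sum_congr rfl fun k hk => (hYeq k ω (hU k hk)).symm
    have hM : ∑ k ∈ Finset.Icc 1 n, μp n k = n * μbar n := by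
      rw [hμbar]
      field_simp
    have hB' := abs_lt.1 (not_le.1 hB)
    rw [← hS', hM] at hB'
    show _ < _ ∧ _ < _
    rw [hlow, lt_div_iff₀ hn0, div_lt_iff₀ hn0]
    constructor <;> linarith [hB'.1, hB'.2]
  have h1 : 1 ≤ P.real E + (P.real B + ∑ k ∈ Finset.Icc 1 n, P.real {ω | (n : ℝ) < |X k ω|}) := by
    rw [← probReal_univ (μ := P)]
    refine (measureReal_mono hcover).trans ((measureReal_union_le _ _).trans ?_)
    gcongr
    refine (measureReal_union_le _ _).trans ?_
    gcongr
    exact measureReal_biUnion_finset_le _ _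
  have h2 : (∑ k ∈ Finset.Icc 1 n, ∫ ω, Y n k ω ^ 2 ∂P) / (n * ε) ^ 2 ≤
      (4 * ψ n 1 + 2 * I n) / ε ^ 2 := by
    rw [mul_pow, ← mul_div_mul_left _ (ε ^ 2) (pow_pos hn0 2).ne']
    gcongr
  change _ ≤ P.real E
  linarith
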